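/- For every preference profile P with responsive hospital and couple preferences, there exists an individually rational matching μ such that: (a) no pair (h,s) with h ∈ H ∪ {λ} and single doctor s blocks μ; (b) no pair ((h₁,h₂),c) with h₁ ≠ h₂ blocks μ; (c) no pair ((λ,λ),c) blocks μ; and (d) for every h ∈ H and every couple c = {f,m}, the pair ((h,h),c) does not block μ whenever at least one of the following holds: f P̄_h m and h P_f μ(f); or m P̄_h f and h P_m μ(m); or μ(f) = h; or μ(m) = h. -/

import Mathlib

/- A formal framework for many-to-one matching markets with couples
(hospitals/doctors), following the paper's definitions.  The dummy hospital
`λ` is modelled as `none : Option H`. -/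

namespace CouplesMarket

open Finset

/-- A strict linear order on a subset `s` of `α`:  trichotomy on `s`,
irreflexivity, transitivity and asymmetry. -/
def StrictLinearOn {α : Type} (s : Set α) (r : α → α → Prop) : Prop :=
  (∀ a ∈ s, ∀ b ∈ s, a = b ∨ r a b ∨ r b a) ∧
  (∀ a ∈ s, ¬ r a a) ∧
  (∀ a ∈ s, ∀ b ∈ s, ∀ c ∈ s, r a b → r b c → r a c) ∧
  (∀ a ∈ s, ∀ b ∈ s, r a b → ¬ r b a)

/-- A strict linear order on all of `α`. -/
def StrictLinear {α : Type} (r : α → α → Prop) : Prop :=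
  StrictLinearOn Set.univ r

/-- The weak (reflexive) part `R` of a strict preference `P`. -/
def weakPref {α : Type} (r : α → α → Prop) (a b : α) : Prop := a = b ∨ r a b

/-- A matching market: hospitals `H` with capacities `κ`, doctors `D`, and a
set of (pairwise disjoint) couples `c = (f, m)` (first component in `F`,
second in `M`; the remaining doctors are single). -/
structure Market (D H : Type) where
  κ : H → ℕ
  couples : Finset (D × D)
  couples_ne : ∀ c ∈ couples, c.1 ≠ c.2
  couples_disjoint : ∀ c ∈ couples, ∀ c' ∈ couples, c ≠ c' →
    c.1 ≠ c'.1 ∧ c.1 ≠ c'.2 ∧ c.2 ≠ c'.1 ∧ c.2 ≠ c'.2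

/-- A doctor is single if he/she belongs to no couple. -/
def Market.Single {D H : Type} (M : Market D H) (d : D) : Prop :=
  ∀ c ∈ M.couples, d ≠ c.1 ∧ d ≠ c.2

/-- A preference profile: for each hospital `h` its set `acc h = D_h` of
acceptable doctors, its linear order `rank h = P̄_h` over individual doctors,
and its preference `hpref h = P_h` over feasible sets of doctors; for each
doctor `d` an individual (resp. marginal, for couple members) preference
`dpref d = P_d` over `H ∪ {λ}`; and for each couple `c` a preference
`cpref c = P_c` over pairs in `(H ∪ {λ})²`. -/
structure Profile (D H : Type) where
  acc : H → Finset D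
  rank : H → D → D → Prop
  hpref : H → Finset D → Finset D → Prop
  dpref : D → Option H → Option H → Prop
  cpref : D × D → Option H × Option H → Option H × Option H → Prop

variable {D H : Type} [Fintype D] [DecidableEq D] [Fintype H] [DecidableEq H]

/-- Responsiveness of hospital `h`'s preference over feasible sets of doctors:
`rank h` is a linear order on `acc h`; `hpref h` is a linear order on feasible
sets; every nonempty feasible subset of acceptable doctors is preferred to `∅`;
singleton comparisons agree with `rank h`; adding a common acceptable doctor to
two feasible subsets of acceptable doctors preserves their comparison; and `∅`
is preferred to every feasible set not contained in `acc h`. -/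
def HospResponsive (M : Market D H) (P : Profile D H) (h : H) : Prop :=
  StrictLinearOn {d | d ∈ P.acc h} (P.rank h) ∧
  StrictLinearOn {A : Finset D | A.card ≤ M.κ h} (P.hpref h) ∧
  (∀ A : Finset D, A ⊆ P.acc h → A.Nonempty → A.card ≤ M.κ h → P.hpref h A ∅) ∧
  (∀ d ∈ P.acc h, ∀ d' ∈ P.acc h, d ≠ d' → (P.hpref h {d} {d'} ↔ P.rank h d d')) ∧
  (∀ A B : Finset D, A ⊆ P.acc h → B ⊆ P.acc h → A.card < M.κ h → B.card < M.κ h →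
      ∀ d ∈ P.acc h, d ∉ A → d ∉ B →
        (P.hpref h (insert d A) (insert d B) ↔ P.hpref h A B)) ∧
  (∀ A : Finset D, A.card ≤ M.κ h → ¬ A ⊆ P.acc h → P.hpref h ∅ A)

/-- Responsiveness of a couple's preference over pairs of hospitals with
respect to the induced marginal preferences of its two members. -/
def CoupleResponsive (P : Profile D H) (c : D × D) : Prop :=
  StrictLinear (P.cpref c) ∧ StrictLinear (P.dpref c.1) ∧ StrictLinear (P.dpref c.2) ∧
  (∀ h h₁ h₂ : Option H,
    (P.cpref c (h₁, h) (h₂, h) ↔ P.dpref c.1 h₁ h₂) ∧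
    (P.cpref c (h, h₁) (h, h₂) ↔ P.dpref c.2 h₁ h₂))

/-- A fully responsive preference profile. -/
def Responsive (M : Market D H) (P : Profile D H) : Prop :=
  (∀ h : H, HospResponsive M P h) ∧
  (∀ c ∈ M.couples, CoupleResponsive P c) ∧
  (∀ d : D, M.Single d → StrictLinear (P.dpref d))

/-- A matching: each doctor is assigned a hospital in `H ∪ {λ}` (where `none`
means unemployed), respecting capacities.  (Disjointness of the hospitals'
sets of doctors is automatic, and the dummy hospital has capacity `|D|`.) -/
structure Matching {D H : Type} [Fintype D] [DecidableEq D] [DecidableEq H]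
    (M : Market D H) : Type where
  assign : D → Option H
  quota : ∀ h : H, (Finset.univ.filter fun d => assign d = some h).card ≤ M.κ h

/-- `μ(h)`, the set of doctors matched with hospital `h`. -/
def Matching.assigned {M : Market D H} (μ : Matching M) (h : H) : Finset D :=
  Finset.univ.filter fun d => μ.assign d = some h

/-- Hospital `h ∈ H ∪ {λ}` prefers the set of doctors `A` to (a subset of) its
assignment at `μ`: there is `B ⊆ μ(h)` disjoint from `A` such that the feasible
set `(μ(h) \ B) ∪ A` is preferred to `μ(h)`.  The dummy hospital always
prefers to have any doctors. -/
def HosPrefers (M : Market D H) (P : Profile D H) (μ : Matching M) :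
    Option H → Finset D → Prop
  | none, _ => True
  | some h, A => ∃ B ⊆ μ.assigned h, Disjoint A B ∧
      ((μ.assigned h \ B) ∪ A).card ≤ M.κ h ∧
      P.hpref h ((μ.assigned h \ B) ∪ A) (μ.assigned h)

/-- The pair `(h, s)` (hospital or dummy, single doctor) blocks `μ`. -/
def BlocksSingle (M : Market D H) (P : Profile D H) (μ : Matching M)
    (h : Option H) (s : D) : Prop :=
  P.dpref s h (μ.assign s) ∧ HosPrefers M P μ h {s}

/-- The pair `((h_f, h_m), c)` (pair of hospitals or dummies, couple `c = (f, m)`)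
blocks `μ`. -/
def BlocksCouple (M : Market D H) (P : Profile D H) (μ : Matching M)
    (hf hm : Option H) (c : D × D) : Prop :=
  P.cpref c (hf, hm) (μ.assign c.1, μ.assign c.2) ∧
  (hf ≠ hm → μ.assign c.1 ≠ hf → HosPrefers M P μ hf {c.1}) ∧
  (hf ≠ hm → μ.assign c.2 ≠ hm → HosPrefers M P μ hm {c.2}) ∧
  (hf = hm → HosPrefers M P μ hf {c.1, c.2})

/-- Stability: no single blocking pair, no couple blocking pair, and no
hospital prefers `∅` to its assignment. -/
def Stable (M : Market D H) (P : Profile D H) (μ : Matching M) : Prop :=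
  (∀ (h : Option H) (s : D), M.Single s → ¬ BlocksSingle M P μ h s) ∧
  (∀ (hf hm : Option H), ∀ c ∈ M.couples, ¬ BlocksCouple M P μ hf hm c) ∧
  (∀ h : H, ¬ HosPrefers M P μ (some h) ∅)

/-- Individual rationality. -/
def IndivRational (M : Market D H) (P : Profile D H) (μ : Matching M) : Prop :=
  (∀ s : D, M.Single s → weakPref (P.dpref s) (μ.assign s) none) ∧
  (∀ c ∈ M.couples, weakPref (P.cpref c) (μ.assign c.1, μ.assign c.2) (none, none)) ∧
  (∀ h : H, ∀ d ∈ μ.assigned h, d ∈ P.acc h)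

/-- Extreme-altruism of the profile of couple preferences: for every couple
`c = (f, m)`, every hospital `h` with `κ_h ≤ |D| - 2` and all
`h', h'' ∈ H ∪ {λ}`:  (i) `h' P_f h`, `h' R_f h''` and `h'' R_m λ` imply
`(h', h'') P_c (h, h)`; and (ii) symmetrically for `m`. -/
def ExtremeAltruism (M : Market D H) (P : Profile D H) : Prop :=
  ∀ c ∈ M.couples, ∀ h : H, M.κ h ≤ Fintype.card D - 2 →
    ∀ h' h'' : Option H,
      ((P.dpref c.1 h' (some h) ∧ weakPref (P.dpref c.1) h' h'' ∧
          weakPref (P.dpref c.2) h'' none) →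
        P.cpref c (h', h'') (some h, some h)) ∧
      ((P.dpref c.2 h' (some h) ∧ weakPref (P.dpref c.2) h' h'' ∧
          weakPref (P.dpref c.1) h'' none) →
        P.cpref c (h'', h') (some h, some h))

/-- Aversion to couple diversity of the profile of hospital preferences: for
every hospital `h`, every couple `c = (f, m)` of acceptable doctors and all
doctors `d₁, d₂` ranked strictly in between `f` and `m` by `h`, if more than
`κ_h` doctors are ranked above the worse member of the couple then
`{d₁, d₂} P_h {f, m}`. -/
def AversionToCoupleDiversity (M : Market D H) (P : Profile D H) : Prop :=
  ∀ h : H, ∀ c ∈ M.couples, c.1 ∈ P.acc h → c.2 ∈ P.acc h → ∀ d₁ d₂ : D,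
    ((P.rank h c.1 d₁ ∧ P.rank h d₁ d₂ ∧ P.rank h d₂ c.2 ∧
        M.κ h < {d : D | P.rank h d c.2}.ncard) ∨
     (P.rank h c.2 d₁ ∧ P.rank h d₁ d₂ ∧ P.rank h d₂ c.1 ∧
        M.κ h < {d : D | P.rank h d c.1}.ncard)) →
    P.hpref h {d₁, d₂} {c.1, c.2}

/-- `P` is an extension of the profile `P₀` of couple preferences: the couple
preferences (and hence their induced marginals) agree with `P₀`. -/
def CoupleExtension (M : Market D H) (P₀ P : Profile D H) : Prop :=
  ∀ c ∈ M.couples, P.cpref c = P₀.cpref c ∧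
    P.dpref c.1 = P₀.dpref c.1 ∧ P.dpref c.2 = P₀.dpref c.2

/-- `P` is an extension of the profile `P₀` of hospital preferences: the
hospital preferences (including the sets of acceptable doctors) agree with `P₀`. -/
def HospitalExtension (P₀ P : Profile D H) : Prop :=
  ∀ h : H, P.acc h = P₀.acc h ∧ P.rank h = P₀.rank h ∧ P.hpref h = P₀.hpref h

end CouplesMarket

namespace CouplesMarket

theorem StrictLinearOn.exists_best {α : Type} {s : Set α} {r : α → α → Prop}
    (hr : StrictLinearOn s r) (S : Finset α) (hS : S.Nonempty) (hsub : ∀ a ∈ S, a ∈ s) :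
    ∃ m ∈ S, ∀ x ∈ S, weakPref r m x := by
  classical
  obtain ⟨htri, -, htrans, -⟩ := hr
  induction hS using Finset.Nonempty.cons_induction with
  | singleton a => exact ⟨a, by simp, by simp [weakPref]⟩
  | cons a S ha hS ih =>
    obtain ⟨m, hm, hbest⟩ := ih fun x hx => hsub x (by simp [hx])
    have has := hsub a (by simp)
    have hms := hsub m (by simp [hm])
    rcases htri m hms a has with h | h | h
    · exact absurd (h ▸ hm) ha
    · refine ⟨m, by simp [hm], fun x hx => ?_⟩
      rcases Finset.mem_cons.1 hx with rfl | hx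
      · exact Or.inr h
      · exact hbest x hx
    · refine ⟨a, by simp, fun x hx => ?_⟩
      rcases Finset.mem_cons.1 hx with rfl | hx'
      · exact Or.inl rfl
      · rcases hbest x hx' with rfl | h'
        · exact Or.inr h
        · exact Or.inr (htrans a has m hms x (hsub x hx) h h')

theorem StrictLinearOn.flip {α : Type} {s : Set α} {r : α → α → Prop}
    (hr : StrictLinearOn s r) : StrictLinearOn s (fun a b => r b a) :=
  ⟨fun a ha b hb => (hr.1 a ha b hb).imp_right Or.symm, hr.2.1,
    fun a ha b hb c hc h h' => hr.2.2.1 c hc b hb a ha h' h,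
    fun a ha b hb h => hr.2.2.2 b hb a ha h⟩

theorem StrictLinear.not_of_weakPref {α : Type} {r : α → α → Prop} (hr : StrictLinear r)
    {a b : α} (h : weakPref r a b) : ¬ r b a := by
  rcases h with rfl | h
  · exact hr.2.1 a trivial
  · exact hr.2.2.2 a trivial b trivial h

theorem StrictLinear.weakPref_of_not {α : Type} {r : α → α → Prop} (hr : StrictLinear r)
    {a b : α} (h : ¬ r b a) : weakPref r a b := by
  rcases hr.1 a trivial b trivial with h' | h' | h'
  · exact Or.inl h'
  · exact Or.inr h'
  · exact absurd h' h

theorem StrictLinear.weakPref_trans {α : Type} {r : α → α → Prop} (hr : StrictLinear r)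
    {a b c : α} (h : weakPref r a b) (h' : weakPref r b c) : weakPref r a c := by
  rcases h with rfl | h
  · exact h'
  · rcases h' with rfl | h'
    · exact Or.inr h
    · exact Or.inr (hr.2.2.1 a trivial b trivial c trivial h h')

/-- Existence of a stable many-to-one assignment, by doctor-proposing deferred acceptance. -/
theorem exists_stable_assignment {D H : Type} [Fintype D] [DecidableEq D] [Fintype H]
    [DecidableEq H] (κ : H → ℕ) (acc : H → Finset D) (rank : H → D → D → Prop)
    (hrank : ∀ h, StrictLinearOn {d | d ∈ acc h} (rank h))
    (pref : D → Option H → Option H → Prop) (hpref : ∀ d, StrictLinear (pref d)) :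
    ∃ a : D → Option H,
      (∀ h, (Finset.univ.filter fun d => a d = some h).card ≤ κ h) ∧
      (∀ d, weakPref (pref d) (a d) none) ∧
      (∀ d h, a d = some h → d ∈ acc h) ∧
      (∀ d h, pref d (some h) (a d) → d ∈ acc h →
        (Finset.univ.filter fun d' => a d' = some h).card = κ h ∧
          ∀ d', a d' = some h → rank h d' d) := by
  classical
  choose best best_mem best_pref using fun (d : D) (S : Finset (Option H)) (hS : S.Nonempty) =>
    (hpref d).exists_best S hS fun _ _ => trivial
  -- the options still open to `d` once the pairs in `R` have been rejected
  let opts : Finset (D × H) → D → Finset (Option H) := fun R d =>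
    Finset.univ.filter fun o => ∀ h, o = some h → (d, h) ∉ R
  have opts_ne : ∀ R d, (opts R d).Nonempty := fun R d => ⟨none, by simp [opts]⟩
  let p : Finset (D × H) → D → Option H := fun R d => best d (opts R d) (opts_ne R d)
  have p_notMem : ∀ R d h, p R d = some h → (d, h) ∉ R := fun R d h hp =>
    (Finset.mem_filter.1 (best_mem d (opts R d) (opts_ne R d))).2 h hp
  have p_insert : ∀ R d h w, w ≠ d → p (insert (d, h) R) w = p R w := by
    intro R d h w hw
    have : opts (insert (d, h) R) w = opts R w := by
      simp [opts, hw]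
    simp only [p, this]
  let Inv : Finset (D × H) → Prop := fun R => ∀ d h, (d, h) ∈ R → d ∈ acc h →
    ∃ W : Finset D, κ h ≤ W.card ∧ ∀ w ∈ W, w ∈ acc h ∧ rank h w d ∧ p R w = some h
  obtain ⟨R, hR, hmax⟩ := (Finset.univ.filter Inv).exists_max_image Finset.card
    ⟨∅, by simp [Inv]⟩
  replace hR : Inv R := (Finset.mem_filter.1 hR).2
  replace hmax : ∀ d h, p R d = some h → ¬ Inv (insert (d, h) R) := by
    intro d h hp hI
    have := hmax _ (Finset.mem_filter.2 ⟨Finset.mem_univ _, hI⟩)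
    rw [Finset.card_insert_of_notMem (p_notMem R d h hp)] at this
    omega
  have hacc : ∀ d h, p R d = some h → d ∈ acc h := by
    intro d h hp
    by_contra hd
    refine hmax d h hp fun e k hek hacc => ?_
    rcases Finset.mem_insert.1 hek with heq | hek
    · obtain ⟨rfl, rfl⟩ := Prod.mk.inj heq
      exact absurd hacc hd
    · obtain ⟨W, hW, hWp⟩ := hR e k hek hacc
      refine ⟨W, hW, fun w hw => ⟨(hWp w hw).1, (hWp w hw).2.1, ?_⟩⟩
      rw [p_insert, (hWp w hw).2.2]
      rintro rfl
      have := (hWp w hw).2.2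
      rw [hp] at this
      cases this
      exact hd (hWp w hw).1
  have hquota : ∀ h, (Finset.univ.filter fun d => p R d = some h).card ≤ κ h := by
    intro h
    by_contra! hlt
    set T := Finset.univ.filter fun d => p R d = some h with hT
    have hTp : ∀ d, d ∈ T ↔ p R d = some h := fun d => by simp [hT]
    obtain ⟨d, hdT, hworst⟩ := (hrank h).flip.exists_best T
      (Finset.card_pos.1 (by omega)) fun d hd => hacc d h ((hTp d).1 hd)
    have hdp := (hTp d).1 hdT
    have hcard : κ h ≤ (T.erase d).card := by rw [Finset.card_erase_of_mem hdT]; omega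
    have herase : ∀ w ∈ T.erase d,
        w ∈ acc h ∧ rank h w d ∧ p (insert (d, h) R) w = some h := by
      intro w hw
      obtain ⟨hwd, hwT⟩ := Finset.mem_erase.1 hw
      refine ⟨hacc w h ((hTp w).1 hwT), (hworst w hwT).resolve_left (Ne.symm hwd), ?_⟩
      rw [p_insert _ _ _ _ hwd, (hTp w).1 hwT]
    refine hmax d h hdp fun e k hek he => ?_
    rcases Finset.mem_insert.1 hek with heq | hek
    · obtain ⟨rfl, rfl⟩ := Prod.mk.inj heq
      exact ⟨T.erase e, hcard, herase⟩
    · obtain ⟨W, hW, hWp⟩ := hR e k hek he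
      by_cases hdW : d ∈ W
      · have hk := (hWp d hdW).2.2
        rw [hdp] at hk
        cases hk
        refine ⟨T.erase d, hcard, fun w hw => ?_⟩
        obtain ⟨h1, h2, h3⟩ := herase w hw
        exact ⟨h1, (hrank h).2.2.1 w h1 d (hWp d hdW).1 e he h2 (hWp d hdW).2.1, h3⟩
      · refine ⟨W, hW, fun w hw => ⟨(hWp w hw).1, (hWp w hw).2.1, ?_⟩⟩
        rw [p_insert _ _ _ _ (by rintro rfl; exact hdW hw), (hWp w hw).2.2]
  refine ⟨p R, hquota, fun d => best_pref d _ (opts_ne R d) none (by simp [opts]), hacc,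
    fun d h hdh hd => ?_⟩
  have hmem : (d, h) ∈ R := by
    by_contra hn
    exact (hpref d).not_of_weakPref
      (best_pref d _ (opts_ne R d) (some h) (by simpa [opts] using hn)) hdh
  obtain ⟨W, hW, hWp⟩ := hR d h hmem hd
  have hsub : W ⊆ Finset.univ.filter fun d' => p R d' = some h := fun w hw => by
    simpa using (hWp w hw).2.2
  have heq := Finset.eq_of_subset_of_card_le hsub ((hquota h).trans hW)
  refine ⟨le_antisymm (hquota h) (heq ▸ hW), fun d' hd' => (hWp d' ?_).2.1⟩
  rw [heq]
  simpa using hd'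

section Responsiveness

variable {D H : Type} {M : Market D H} {P : Profile D H} {h : H}

theorem CoupleResponsive.weakPref {c : D × D} (hc : CoupleResponsive P c)
    {a a' b b' : Option H} (ha : weakPref (P.dpref c.1) a a')
    (hb : weakPref (P.dpref c.2) b b') : weakPref (P.cpref c) (a, b) (a', b') :=
  hc.1.weakPref_trans (b := (a', b))
    (ha.imp (fun h => by rw [h]) (hc.2.2.2 b a a').1.2)
    (hb.imp (fun h => by rw [h]) (hc.2.2.2 a' b b').2.2)

theorem CoupleResponsive.dpref_or_dpref {c : D × D} (hc : CoupleResponsive P c)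
    {a a' b b' : Option H} (hcp : P.cpref c (a, b) (a', b')) :
    P.dpref c.1 a a' ∨ P.dpref c.2 b b' := by
  by_contra! hn
  exact hc.1.not_of_weakPref
    (hc.weakPref (hc.2.1.weakPref_of_not hn.1) (hc.2.2.1.weakPref_of_not hn.2)) hcp

variable [DecidableEq D]

theorem HospResponsive.hpref_union (hP : HospResponsive M P h) {A B : Finset D} (Z : Finset D)
    (hA : A ⊆ P.acc h) (hB : B ⊆ P.acc h) (hZ : Z ⊆ P.acc h)
    (hAZ : Disjoint A Z) (hBZ : Disjoint B Z)
    (hAc : (A ∪ Z).card ≤ M.κ h) (hBc : (B ∪ Z).card ≤ M.κ h) (hAB : P.hpref h A B) :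
    P.hpref h (A ∪ Z) (B ∪ Z) := by
  induction Z using Finset.induction_on with
  | empty => simpa using hAB
  | insert z Z hz ih =>
    obtain ⟨hzA, hAZ⟩ := Finset.disjoint_insert_right.1 hAZ
    obtain ⟨hzB, hBZ⟩ := Finset.disjoint_insert_right.1 hBZ
    obtain ⟨hzacc, hZ⟩ := Finset.insert_subset_iff.1 hZ
    have hzAZ : z ∉ A ∪ Z := by simp [hzA, hz]
    have hzBZ : z ∉ B ∪ Z := by simp [hzB, hz]
    rw [Finset.union_insert, Finset.card_insert_of_notMem hzAZ] at hAc
    rw [Finset.union_insert, Finset.card_insert_of_notMem hzBZ] at hBc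
    rw [Finset.union_insert, Finset.union_insert]
    exact (hP.2.2.2.2.1 _ _ (Finset.union_subset hA hZ) (Finset.union_subset hB hZ)
      hAc hBc z hzacc hzAZ hzBZ).2 (ih hZ hAZ hBZ (by omega) (by omega))

theorem HospResponsive.weakPref_of_subset (hP : HospResponsive M P h) {U T : Finset D}
    (hT : T ⊆ P.acc h) (hTc : T.card ≤ M.κ h) (hUT : U ⊆ T) :
    weakPref (P.hpref h) T U := by
  rcases (T \ U).eq_empty_or_nonempty with he | hne
  · exact Or.inl (Finset.Subset.antisymm (Finset.sdiff_eq_empty_iff_subset.1 he) hUT)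
  · right
    have hsub : T \ U ⊆ P.acc h := Finset.sdiff_subset.trans hT
    have := hP.hpref_union (A := T \ U) (B := ∅) U hsub (by simp) (hUT.trans hT)
      Finset.sdiff_disjoint (by simp) (by rwa [Finset.sdiff_union_of_subset hUT])
      (by simpa using (Finset.card_le_card hUT).trans hTc)
      (hP.2.2.1 _ hsub hne ((Finset.card_le_card Finset.sdiff_subset).trans hTc))
    rwa [Finset.sdiff_union_of_subset hUT, Finset.empty_union] at this

theorem HospResponsive.weakPref_of_rank (hP : HospResponsive M P h) {T : Finset D}
    (hT : T ⊆ P.acc h) (hTc : T.card ≤ M.κ h) {U : Finset D} (hU : U ⊆ P.acc h)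
    (hUT : U.card ≤ T.card) (hr : ∀ x ∈ U \ T, ∀ y ∈ T \ U, P.rank h y x) :
    weakPref (P.hpref h) T U := by
  induction hn : (U \ T).card generalizing U with
  | zero =>
    exact hP.weakPref_of_subset hT hTc
      (Finset.sdiff_eq_empty_iff_subset.1 (Finset.card_eq_zero.1 hn))
  | succ n ih =>
    obtain ⟨x, hx⟩ := Finset.card_pos.1 (by omega : 0 < (U \ T).card)
    have hle : (U \ T).card ≤ (T \ U).card := by
      have h1 := Finset.card_sdiff_add_card_inter U T
      have h2 := Finset.card_sdiff_add_card_inter T U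
      rw [Finset.inter_comm] at h2
      omega
    obtain ⟨y, hy⟩ := Finset.card_pos.1 (by omega : 0 < (T \ U).card)
    obtain ⟨hxU, hxT⟩ := Finset.mem_sdiff.1 hx
    obtain ⟨hyT, hyU⟩ := Finset.mem_sdiff.1 hy
    have hyx := hr x hx y hy
    have hxy : y ≠ x := by rintro rfl; exact hxT hyT
    have hyacc := hT hyT
    have hcardU := Finset.card_erase_of_mem hxU
    have hposU := Finset.card_pos.2 ⟨x, hxU⟩
    have hV : ({y} ∪ U.erase x).card = U.card := by
      rw [← Finset.insert_eq, Finset.card_insert_of_notMem (by simp [hyU])]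
      omega
    have hxe : {x} ∪ U.erase x = U := by
      rw [← Finset.insert_eq, Finset.insert_erase hxU]
    have herase : U.erase x ⊆ P.acc h := (Finset.erase_subset _ _).trans hU
    have hstep : P.hpref h ({y} ∪ U.erase x) U := by
      have := hP.hpref_union (A := {y}) (B := {x}) (U.erase x) (by simpa using hyacc)
        (by simpa using hU hxU) herase (by simp [hyU]) (by simp) (by omega)
        (by rw [hxe]; omega) ((hP.2.2.2.1 y hyacc x (hU hxU) hxy).2 hyx)
      rwa [hxe] at this
    have hdiff : ({y} ∪ U.erase x) \ T = (U \ T).erase x := by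
      ext z
      by_cases hzy : z = y
      · subst hzy; simp [hyT]
      · simp [hzy]; tauto
    have hrec := ih (U := {y} ∪ U.erase x)
      (Finset.union_subset (by simpa using hyacc) herase) (by omega)
      (fun a ha b hb => hr a (Finset.mem_of_mem_erase (hdiff ▸ ha)) b (by
        simp only [Finset.mem_sdiff, Finset.mem_union, Finset.mem_singleton,
          Finset.mem_erase] at hb ⊢
        refine ⟨hb.1, fun hbU => hb.2 (Or.inr ⟨?_, hbU⟩)⟩
        rintro rfl
        exact hxT hb.1))
      (by rw [hdiff, Finset.card_erase_of_mem hx]; omega)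
    rcases hrec with heq | hrec
    · right; rw [heq]; exact hstep
    · exact Or.inr (hP.2.1.2.2.1 T hTc _ (hV.trans_le (hUT.trans hTc)) U
        (hUT.trans hTc) hrec hstep)

theorem HospResponsive.not_hosPrefers [Fintype D] [DecidableEq H] (hP : HospResponsive M P h) (μ : Matching M)
    (hacc : μ.assigned h ⊆ P.acc h) (A : Finset D)
    (hA : A ⊆ P.acc h → ∀ a ∈ A, a ∈ μ.assigned h ∨
      ((μ.assigned h).card = M.κ h ∧ ∀ y ∈ μ.assigned h, P.rank h y a)) :
    ¬ HosPrefers M P μ (some h) A := by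
  rintro ⟨B, hB, -, hcard, hpref⟩
  have hq : (μ.assigned h).card ≤ M.κ h := μ.quota h
  set T := μ.assigned h
  set U := (T \ B) ∪ A with hU
  have key : weakPref (P.hpref h) T U := by
    by_cases hUacc : U ⊆ P.acc h
    · have hA' := hA (Finset.subset_union_right.trans hUacc)
      have hUT : ∀ x ∈ U \ T, x ∈ A := by
        intro x hx
        simp only [hU, Finset.mem_sdiff, Finset.mem_union] at hx
        tauto
      by_cases hsub : U ⊆ T
      · exact hP.weakPref_of_subset hacc hq hsub
      · obtain ⟨x, hxU, hxT⟩ := Finset.not_subset.1 hsub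
        have hfull := ((hA' x (hUT x (by simp [hxU, hxT]))).resolve_left hxT).1
        exact hP.weakPref_of_rank hacc hq hUacc (by omega) fun x hx y hy =>
          ((hA' x (hUT x hx)).resolve_left (Finset.mem_sdiff.1 hx).2).2 y
            (Finset.mem_sdiff.1 hy).1
    · have hempty := hP.2.2.2.2.2 U hcard hUacc
      rcases hP.weakPref_of_subset hacc hq (Finset.empty_subset T) with heq | hT
      · exact Or.inr (heq ▸ hempty)
      · exact Or.inr (hP.2.1.2.2.1 T hq ∅ (by simp) U hcard hT hempty)
  rcases key with heq | key
  · rw [← heq] at hpref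
    exact hP.2.1.2.1 T hq hpref
  · exact hP.2.1.2.2.2 T hq U hcard key hpref

theorem Responsive.strictLinear_dpref (hP : Responsive M P) (d : D) :
    StrictLinear (P.dpref d) := by
  by_cases hd : M.Single d
  · exact hP.2.2 d hd
  · simp only [Market.Single, not_forall] at hd
    obtain ⟨c, hc, hdc⟩ := hd
    obtain ⟨-, h1, h2, -⟩ := hP.2.1 c hc
    by_cases hd1 : d = c.1
    · rwa [hd1]
    · rwa [show d = c.2 from by tauto]

end Responsiveness

/-- For every responsive profile there is an individually rational matching
that is blocked neither by a pair `(h, s)` with `s` single, nor by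
`((h₁, h₂), c)` with `h₁ ≠ h₂`, nor by `((λ, λ), c)`; and moreover
`((h, h), c)` does not block it whenever `f P̄_h m` and `h P_f μ(f)`, or
`m P̄_h f` and `h P_m μ(m)`, or some member of the couple is matched to `h`. -/
theorem exists_matching_with_restricted_same_hospital_blocks
    {D H : Type} [Fintype D] [DecidableEq D] [Fintype H] [DecidableEq H]
    (M : Market D H) (hκ : ∀ h : H, 2 ≤ M.κ h)
    (P : Profile D H) (hresp : Responsive M P) :
    ∃ μ : Matching M, IndivRational M P μ ∧
      (∀ (h : Option H) (s : D), M.Single s → ¬ BlocksSingle M P μ h s) ∧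
      (∀ h₁ h₂ : H, h₁ ≠ h₂ → ∀ c ∈ M.couples,
        ¬ BlocksCouple M P μ (some h₁) (some h₂) c) ∧
      (∀ c ∈ M.couples, ¬ BlocksCouple M P μ none none c) ∧
      (∀ h : H, ∀ c ∈ M.couples,
        ((P.rank h c.1 c.2 ∧ P.dpref c.1 (some h) (μ.assign c.1)) ∨
         (P.rank h c.2 c.1 ∧ P.dpref c.2 (some h) (μ.assign c.2)) ∨
         μ.assign c.1 = some h ∨ μ.assign c.2 = some h) →
        ¬ BlocksCouple M P μ (some h) (some h) c) := by
  obtain ⟨a, hquota, hir, hacc, hstable⟩ := exists_stable_assignment M.κ P.acc P.rank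
    (fun h => (hresp.1 h).1) P.dpref hresp.strictLinear_dpref
  let μ : Matching M := ⟨a, hquota⟩
  have mem_assigned : ∀ h d, d ∈ μ.assigned h ↔ a d = some h := fun h d => by
    simp [Matching.assigned, μ]
  have hsub : ∀ h, μ.assigned h ⊆ P.acc h := fun h d hd =>
    hacc d h ((mem_assigned h d).1 hd)
  have hfull : ∀ h d, P.dpref d (some h) (a d) → d ∈ P.acc h →
      (μ.assigned h).card = M.κ h ∧ ∀ y ∈ μ.assigned h, P.rank h y d := fun h d hd hda =>
    ⟨(hstable d h hd hda).1, fun y hy => (hstable d h hd hda).2 y ((mem_assigned h y).1 hy)⟩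
  have hsingle : ∀ h d, P.dpref d (some h) (a d) → ¬ HosPrefers M P μ (some h) {d} := by
    intro h d hd
    refine (hresp.1 h).not_hosPrefers μ (hsub h) _ fun hA x hx => Or.inr ?_
    obtain rfl := Finset.mem_singleton.1 hx
    exact hfull h x hd (hA hx)
  have hne : ∀ h d, P.dpref d (some h) (a d) → a d ≠ some h := fun h d hd heq =>
    (hresp.strictLinear_dpref d).2.1 (some h) trivial (heq ▸ hd)
  have hcouple : ∀ c ∈ M.couples,
      weakPref (P.cpref c) (μ.assign c.1, μ.assign c.2) (none, none) := fun c hc =>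
    (hresp.2.1 c hc).weakPref (hir c.1) (hir c.2)
  refine ⟨μ, ⟨fun s _ => hir s, hcouple, fun h d hd => hsub h hd⟩, ?_, ?_, ?_, ?_⟩
  · rintro (_ | h) s - ⟨hs, hh⟩
    · exact (hresp.strictLinear_dpref s).not_of_weakPref (hir s) hs
    · exact hsingle h s hs hh
  · rintro h₁ h₂ hh c hc ⟨hcp, hf, hm, -⟩
    have hh' : some h₁ ≠ some h₂ := by simpa using hh
    rcases (hresp.2.1 c hc).dpref_or_dpref hcp with hd | hd
    · exact hsingle h₁ c.1 hd (hf hh' (hne h₁ c.1 hd))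
    · exact hsingle h₂ c.2 hd (hm hh' (hne h₂ c.2 hd))
  · rintro c hc ⟨hcp, -⟩
    exact (hresp.2.1 c hc).1.not_of_weakPref (hcouple c hc) hcp
  · rintro h c hc hcase ⟨hcp, -, -, hh⟩
    have hcp := (hresp.2.1 c hc).dpref_or_dpref hcp
    refine (hresp.1 h).not_hosPrefers μ (hsub h) _ (fun hA x hx => ?_) (hh rfl)
    have h1 : c.1 ∈ P.acc h := hA (by simp)
    have h2 : c.2 ∈ P.acc h := hA (by simp)
    have htrans := (hresp.1 h).1.2.2.1
    have hx : x = c.1 ∨ x = c.2 := by simpa using hx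
    rcases hcase with ⟨hr, hd⟩ | ⟨hr, hd⟩ | hd | hd
    · obtain ⟨hk, hy⟩ := hfull h c.1 hd h1
      rcases hx with rfl | rfl
      · exact Or.inr ⟨hk, hy⟩
      · exact Or.inr ⟨hk, fun y hyT => htrans y (hsub h hyT) _ h1 _ h2 (hy y hyT) hr⟩
    · obtain ⟨hk, hy⟩ := hfull h c.2 hd h2
      rcases hx with rfl | rfl
      · exact Or.inr ⟨hk, fun y hyT => htrans y (hsub h hyT) _ h2 _ h1 (hy y hyT) hr⟩
      · exact Or.inr ⟨hk, hy⟩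
    · rcases hx with rfl | rfl
      · exact Or.inl ((mem_assigned h _).2 hd)
      · exact Or.inr (hfull h _ (hcp.resolve_left fun hd' => hne h _ hd' hd) h2)
    · rcases hx with rfl | rfl
      · exact Or.inr (hfull h _ (hcp.resolve_right fun hd' => hne h _ hd' hd) h1)
      · exact Or.inl ((mem_assigned h _).2 hd)

end CouplesMarket
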